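/- Let σ: [0,T) → (0,1] be continuously differentiable with σ' < 0, σ(0) = 1, and β_t := 1 − σ_t. Let η be an ℝ^d-valued random variable with ‖η‖₂ ≤ K almost surely, and define b_t(x) := (σ_t'/σ_t)[x − D_t(x)] where D_t(x) := E[η e^{-‖x−β_t η‖₂²/(2σ_t²)}]/E[e^{-‖x−β_t η‖₂²/(2σ_t²)}]. Then for all x, y ∈ ℝ^d, ⟨x − y, b_t(x) − b_t(y)⟩ ≤ (σ_t'/σ_t)(1 − β_t K²/σ_t²)‖x − y‖₂². -/

import Mathlib

open MeasureTheory Real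
open scoped RealInnerProductSpace

noncomputable def driftD {Ω : Type*} [MeasurableSpace Ω] (μ : Measure Ω) {d : ℕ}
    (η : Ω → EuclideanSpace ℝ (Fin d)) (β σ : ℝ) (x : EuclideanSpace ℝ (Fin d)) :
    EuclideanSpace ℝ (Fin d) :=
  (∫ ω, Real.exp (-(‖x - β • η ω‖ ^ 2 / (2 * σ ^ 2))) ∂μ)⁻¹ •
    ∫ ω, Real.exp (-(‖x - β • η ω‖ ^ 2 / (2 * σ ^ 2))) • η ω ∂μ

/-- The drift `b_t(x) = (σ_t'/σ_t)[x - D_t(x)]` of the probability flow ODE. -/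
noncomputable def driftB {Ω : Type*} [MeasurableSpace Ω] (μ : Measure Ω) {d : ℕ}
    (η : Ω → EuclideanSpace ℝ (Fin d)) (σ σ' : ℝ → ℝ) (t : ℝ)
    (x : EuclideanSpace ℝ (Fin d)) : EuclideanSpace ℝ (Fin d) :=
  (σ' t / σ t) • (x - driftD μ η (1 - σ t) (σ t) x)

open ProbabilityTheory

/-- The mean of a bounded random variable under its exponential tilts grows at most linearly. -/
lemma integral_tilted_mul_sub_integral_le {Ω : Type*} [MeasurableSpace Ω] {μ : Measure Ω}
    [IsProbabilityMeasure μ] {X : Ω → ℝ} {M s : ℝ} (hX : AEMeasurable X μ)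
    (hM : ∀ᵐ ω ∂μ, X ω ∈ Set.Icc (-M) M) (hs : 0 ≤ s) :
    ∫ ω, X ω ∂(μ.tilted (s * X ·)) - ∫ ω, X ω ∂μ ≤ M ^ 2 * s := by
  have hint (u : ℝ) : Integrable (fun ω ↦ exp (u * X ω)) μ := integrable_exp_mul_of_mem_Icc hX hM
  have hmem (u : ℝ) : u ∈ interior (integrableExpSet X μ) := by
    rw [Set.eq_univ_of_forall (s := integrableExpSet X μ) hint]
    simp
  have hdiff : Differentiable ℝ (deriv (cgf X μ)) :=
    fun u ↦ (analyticAt_cgf (hmem u)).deriv.differentiableAt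
  have hderiv (u : ℝ) : deriv (deriv (cgf X μ)) u ≤ M ^ 2 := by
    have : IsProbabilityMeasure (μ.tilted (u * X ·)) := isProbabilityMeasure_tilted (hint u)
    have hac := tilted_absolutelyContinuous μ (u * X ·)
    rw [← iteratedDeriv_one (f := cgf X μ), ← iteratedDeriv_succ, ← variance_tilted_mul (hmem u)]
    refine (variance_le_sq_of_bounded (hac hM) (hX.mono_ac hac)).trans_eq ?_
    ring
  have hmvt := image_sub_le_mul_sub_of_deriv_le hdiff hderiv hs
  rw [← integral_tilted_mul_self (hmem s), deriv_cgf_zero (hmem 0)] at hmvt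
  simpa using hmvt

/-- The conditional expectation `driftD` is a mean under a tilted measure. -/
lemma driftD_eq_integral_tilted {Ω : Type*} [MeasurableSpace Ω] (μ : Measure Ω) {d : ℕ}
    (η : Ω → EuclideanSpace ℝ (Fin d)) (β σ : ℝ) (x : EuclideanSpace ℝ (Fin d)) :
    driftD μ η β σ x =
      ∫ ω, η ω ∂(μ.tilted fun ω ↦ -(‖x - β • η ω‖ ^ 2 / (2 * σ ^ 2))) := by
  rw [driftD, integral_tilted, ← integral_smul]
  simp only [smul_smul, div_eq_inv_mul]

lemma integrable_exp_neg_norm_sub_sq_div {Ω : Type*} [MeasurableSpace Ω] {μ : Measure Ω}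
    [IsFiniteMeasure μ] {d : ℕ} {η : Ω → EuclideanSpace ℝ (Fin d)} (hη : Measurable η)
    (β σ : ℝ) (x : EuclideanSpace ℝ (Fin d)) :
    Integrable (fun ω ↦ exp (-(‖x - β • η ω‖ ^ 2 / (2 * σ ^ 2)))) μ := by
  refine Integrable.of_bound (C := 1) (by fun_prop) (ae_of_all _ fun ω ↦ ?_)
  rw [norm_of_nonneg (exp_nonneg _), exp_le_one_iff, neg_nonpos]
  positivity

/-- Moving the base point of the Gaussian weight from `y` to `x` is an exponential tilt along
`x - y`. -/
lemma tilted_neg_norm_sub_sq_div {Ω : Type*} [MeasurableSpace Ω] {μ : Measure Ω}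
    [IsProbabilityMeasure μ] {d : ℕ} {η : Ω → EuclideanSpace ℝ (Fin d)} (hη : Measurable η)
    (β σ : ℝ) (x y : EuclideanSpace ℝ (Fin d)) :
    (μ.tilted fun ω ↦ -(‖x - β • η ω‖ ^ 2 / (2 * σ ^ 2))) =
      (μ.tilted fun ω ↦ -(‖y - β • η ω‖ ^ 2 / (2 * σ ^ 2))).tilted
        (fun ω ↦ β / σ ^ 2 * ⟪x - y, η ω⟫) := by
  have hy := integrable_exp_neg_norm_sub_sq_div (μ := μ) hη β σ y
  have := isProbabilityMeasure_tilted hy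
  rw [← tilted_const (μ.tilted fun ω ↦ -(‖y - β • η ω‖ ^ 2 / (2 * σ ^ 2)))
    ((‖y‖ ^ 2 - ‖x‖ ^ 2) / (2 * σ ^ 2)), tilted_tilted (by simp), tilted_tilted hy]
  congr 1
  ext ω
  simp only [Pi.add_apply, norm_sub_sq_real, inner_smul_right, inner_sub_left]
  ring

lemma inner_driftD_sub_le {Ω : Type*} [MeasurableSpace Ω] {μ : Measure Ω}
    [IsProbabilityMeasure μ] {d : ℕ} {η : Ω → EuclideanSpace ℝ (Fin d)} (hη : Measurable η)
    {K : ℝ} (hK : ∀ᵐ ω ∂μ, ‖η ω‖ ≤ K) {β : ℝ} (hβ : 0 ≤ β) (σ : ℝ)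
    (x y : EuclideanSpace ℝ (Fin d)) :
    ⟪x - y, driftD μ η β σ x - driftD μ η β σ y⟫ ≤ β * K ^ 2 / σ ^ 2 * ‖x - y‖ ^ 2 := by
  have hinner (z : EuclideanSpace ℝ (Fin d)) : ⟪x - y, driftD μ η β σ z⟫ =
      ∫ ω, ⟪x - y, η ω⟫ ∂(μ.tilted fun ω ↦ -(‖z - β • η ω‖ ^ 2 / (2 * σ ^ 2))) := by
    have := isProbabilityMeasure_tilted (integrable_exp_neg_norm_sub_sq_div (μ := μ) hη β σ z)
    rw [driftD_eq_integral_tilted]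
    exact (integral_inner (Integrable.of_bound hη.aestronglyMeasurable K
      (tilted_absolutelyContinuous _ _ hK)) _).symm
  have := isProbabilityMeasure_tilted (integrable_exp_neg_norm_sub_sq_div (μ := μ) hη β σ y)
  rw [inner_sub_right, hinner, hinner, tilted_neg_norm_sub_sq_div hη β σ x y]
  refine (integral_tilted_mul_sub_integral_le (M := K * ‖x - y‖) (by fun_prop) ?_
    (by positivity)).trans_eq (by ring)
  filter_upwards [tilted_absolutelyContinuous _ _ hK] with ω hω
  rw [Set.mem_Icc, ← abs_le, mul_comm]
  exact (abs_real_inner_le_norm _ _).trans (by gcongr)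

theorem one_sided_lipschitz_driftB {Ω : Type*} [MeasurableSpace Ω] (μ : Measure Ω)
    [IsProbabilityMeasure μ] {d : ℕ} (T : ℝ) (hT : 0 < T)
    (σ σ' : ℝ → ℝ)
    (hderiv : ∀ t ∈ Set.Ico (0:ℝ) T, HasDerivAt σ (σ' t) t)
    (hcont : ContinuousOn σ' (Set.Ico (0:ℝ) T))
    (hσmem : ∀ t ∈ Set.Ico (0:ℝ) T, σ t ∈ Set.Ioc (0:ℝ) 1)
    (hσ' : ∀ t ∈ Set.Ico (0:ℝ) T, σ' t < 0)
    (hσ0 : σ 0 = 1)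
    (η : Ω → EuclideanSpace ℝ (Fin d)) (hηm : Measurable η)
    (K : ℝ) (hηb : ∀ᵐ ω ∂μ, ‖η ω‖ ≤ K) :
    ∀ t ∈ Set.Ico (0:ℝ) T, ∀ x y : EuclideanSpace ℝ (Fin d),
      ⟪x - y, driftB μ η σ σ' t x - driftB μ η σ σ' t y⟫ ≤
        (σ' t / σ t) * (1 - (1 - σ t) * K ^ 2 / (σ t) ^ 2) * ‖x - y‖ ^ 2 := by
  intro t ht x y
  have hσ := hσmem t ht
  have hD := inner_driftD_sub_le hηm hηb (sub_nonneg.2 hσ.2) (σ t) x y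
  have hc : σ' t / σ t ≤ 0 := div_nonpos_of_nonpos_of_nonneg (hσ' t ht).le hσ.1.le
  rw [driftB, driftB, ← smul_sub, inner_smul_right, sub_sub_sub_comm, inner_sub_right,
    real_inner_self_eq_norm_sq, mul_assoc]
  exact mul_le_mul_of_nonpos_left (by linarith) hc
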